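/- arXiv:2402.13816 — 3 statements merged into one kernel-verified Lean document; each statement's English description precedes it below -/
import Mathlib

section
/- Let k be a positive integer and let Q, C ∈ ℝ^{k×k} with Q symmetric positive definite. Let 𝟙_k ∈ ℝ^k denote the all-ones vector and set Θ* = I_k − ( Q⁻¹ − (Q⁻¹𝟙_k)(Q⁻¹𝟙_k)ᵀ / (𝟙_kᵀ Q⁻¹ 𝟙_k) ) (Q + C). Then Θ* satisfies (Θ*)ᵀ𝟙_k = 𝟙_k, and Θ* minimizes the function Θ ↦ tr((1/2)·Θᵀ Q Θ + Cᵀ Θ) over the set {Θ ∈ ℝ^{k×k} : Θᵀ𝟙_k = 𝟙_k}; that is, for every Θ ∈ ℝ^{k×k} with Θᵀ𝟙_k = 𝟙_k, the objective at Θ* is less than or equal to the objective at Θ. -/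
open Matrix

/-- The objective `Θ ↦ tr((1/2)·Θᵀ Q Θ + Cᵀ Θ)`. -/
noncomputable def quadObj {k : ℕ} (Q C Θ : Matrix (Fin k) (Fin k) ℝ) : ℝ :=
  Matrix.trace ((1 / 2 : ℝ) • (Θᵀ * Q * Θ) + Cᵀ * Θ)

/-- The all-ones vector `𝟙_k`. -/
def onesVec (k : ℕ) : Fin k → ℝ := fun _ => 1

/-- Second-order expansion of the quadratic objective around `A`. -/
theorem quadObj_add {k : ℕ} (Q C A D : Matrix (Fin k) (Fin k) ℝ) (hQ : Qᵀ = Q) :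
    quadObj Q C (A + D) =
      quadObj Q C A + (1 / 2) * trace (Dᵀ * Q * D) + trace (Dᵀ * (Q * A + C)) := by
  have h₁ : trace (Aᵀ * Q * D) = trace (Dᵀ * Q * A) := by
    rw [← trace_transpose (Aᵀ * Q * D)]
    simp [transpose_mul, hQ, Matrix.mul_assoc]
  have h₂ : trace (Cᵀ * D) = trace (Dᵀ * C) := by
    rw [← trace_transpose (Cᵀ * D)]
    simp [transpose_mul]
  simp only [quadObj, transpose_add, Matrix.add_mul, Matrix.mul_add, trace_add, trace_smul,
    smul_eq_mul, ← Matrix.mul_assoc]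
  linear_combination (1 / 2) * h₁ + h₂

/-- If the gradient `Q * A + C` is `𝟙 μᵀ`, then `A` minimizes the objective among the matrices
with the same column sums. -/
theorem quadObj_le_of_gradient_eq {k : ℕ} {Q C A B : Matrix (Fin k) (Fin k) ℝ} (hQ : Q.PosDef)
    {μ : Fin k → ℝ} (hgrad : Q * A + C = vecMulVec (onesVec k) μ)
    (hAB : Aᵀ *ᵥ onesVec k = Bᵀ *ᵥ onesVec k) : quadObj Q C A ≤ quadObj Q C B := by
  have hT : Qᵀ = Q := by simpa using hQ.isHermitian.eq
  have hD : (B - A)ᵀ *ᵥ onesVec k = 0 := by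
    rw [transpose_sub, Matrix.sub_mulVec, hAB, sub_self]
  have hpos : 0 ≤ trace ((B - A)ᵀ * Q * (B - A)) := by
    simpa using (hQ.posSemidef.conjTranspose_mul_mul_same (B - A)).trace_nonneg
  have h := quadObj_add Q C A (B - A) hT
  rw [add_sub_cancel, hgrad, mul_vecMulVec, hD, zero_vecMulVec, trace_zero] at h
  linarith

theorem stmt1 (k : ℕ) (hk : 0 < k) (Q C : Matrix (Fin k) (Fin k) ℝ) (hQ : Q.PosDef) :
    let u : Fin k → ℝ := Q⁻¹.mulVec (onesVec k)
    let Θs : Matrix (Fin k) (Fin k) ℝ :=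
      1 - (Q⁻¹ - (onesVec k ⬝ᵥ u)⁻¹ • vecMulVec u u) * (Q + C)
    Θsᵀ.mulVec (onesVec k) = onesVec k ∧
    ∀ Θ : Matrix (Fin k) (Fin k) ℝ,
      Θᵀ.mulVec (onesVec k) = onesVec k → quadObj Q C Θs ≤ quadObj Q C Θ := by
  intro u Θs
  have hdet : IsUnit Q.det := (Matrix.isUnit_iff_isUnit_det Q).mp hQ.isUnit
  have hinvT : Q⁻¹ᵀ = Q⁻¹ := by simpa using hQ.inv.isHermitian.eq
  have hones : onesVec k ≠ 0 := fun h => one_ne_zero (congrFun h ⟨0, hk⟩)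
  have hs : onesVec k ⬝ᵥ u ≠ 0 := by
    simpa using (hQ.inv.dotProduct_mulVec_pos hones).ne'
  have hleft : onesVec k ᵥ* Q⁻¹ = u := by
    rw [← mulVec_transpose, hinvT]
  have hQu : Q *ᵥ u = onesVec k := by
    simp [u, mulVec_mulVec, Matrix.mul_nonsing_inv Q hdet]
  have hfeas : Θsᵀ *ᵥ onesVec k = onesVec k := by
    rw [mulVec_transpose]
    simp only [Θs]
    rw [vecMul_sub, vecMul_one, ← vecMul_vecMul, vecMul_sub, hleft, vecMul_smul,
      vecMul_vecMulVec, smul_smul, inv_mul_cancel₀ hs, one_smul, sub_self, zero_vecMul, sub_zero]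
  have hgrad : Q * Θs + C =
      vecMulVec (onesVec k) ((onesVec k ⬝ᵥ u)⁻¹ • (u ᵥ* (Q + C))) := by
    simp only [Θs]
    rw [Matrix.mul_sub, ← Matrix.mul_assoc, Matrix.mul_sub, Matrix.mul_nonsing_inv Q hdet,
      Matrix.mul_smul, mul_vecMulVec, hQu, Matrix.sub_mul, Matrix.smul_mul, vecMulVec_mul,
      vecMulVec_smul, Matrix.mul_one, Matrix.one_mul]
    abel
  exact ⟨hfeas, fun Θ hΘ => quadObj_le_of_gradient_eq hQ hgrad (hfeas.trans hΘ.symm)⟩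
end

section
/- Let X ∈ ℝ^{n×k} and let D ∈ ℝ^{k×k} be a diagonal matrix such that Q = XᵀX + D is positive definite. Then the function Θ ↦ ‖XΘ − X‖_F² + tr(Θᵀ D Θ) on ℝ^{k×k} attains its unique global minimum at Θ* = I_k − Q⁻¹D; that is, for every Θ ∈ ℝ^{k×k}, the objective at Θ* is less than or equal to the objective at Θ, with equality if and only if Θ = Θ*. -/
open Matrix

/-- Squared Frobenius norm of a real matrix. -/
noncomputable def frobSq {n k : ℕ} (M : Matrix (Fin n) (Fin k) ℝ) : ℝ :=
  ∑ i, ∑ j, (M i j) ^ 2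

theorem frobSq_eq_trace {n k : ℕ} (M : Matrix (Fin n) (Fin k) ℝ) :
    frobSq M = trace (Mᵀ * M) := by
  simp only [frobSq, trace, diag_apply, mul_apply, transpose_apply, sq]
  exact Finset.sum_comm

theorem trace_transpose_mul_mul_eq_sum {k : ℕ} (Q E : Matrix (Fin k) (Fin k) ℝ) :
    trace (Eᵀ * Q * E) = ∑ j, star (E.col j) ⬝ᵥ (Q *ᵥ E.col j) := by
  rw [Matrix.mul_assoc]
  rfl

theorem trace_transpose_mul_mul_comm {k : ℕ} {Q : Matrix (Fin k) (Fin k) ℝ} (hQ : Qᵀ = Q)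
    (A B : Matrix (Fin k) (Fin k) ℝ) :
    trace (Aᵀ * Q * B) = trace (Bᵀ * Q * A) := by
  rw [← trace_transpose (Aᵀ * Q * B)]
  simp only [transpose_mul, transpose_transpose, hQ, Matrix.mul_assoc]

theorem trace_transpose_mul_mul_nonneg {k : ℕ} {Q : Matrix (Fin k) (Fin k) ℝ} (hQ : Q.PosDef)
    (E : Matrix (Fin k) (Fin k) ℝ) : 0 ≤ trace (Eᵀ * Q * E) := by
  rw [trace_transpose_mul_mul_eq_sum]
  exact Finset.sum_nonneg fun j _ => hQ.posSemidef.dotProduct_mulVec_nonneg _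

theorem trace_transpose_mul_mul_eq_zero_iff {k : ℕ} {Q : Matrix (Fin k) (Fin k) ℝ}
    (hQ : Q.PosDef) (E : Matrix (Fin k) (Fin k) ℝ) : trace (Eᵀ * Q * E) = 0 ↔ E = 0 := by
  refine ⟨fun h => ?_, fun h => by simp [h]⟩
  rw [trace_transpose_mul_mul_eq_sum, Finset.sum_eq_zero_iff_of_nonneg
    fun j _ => hQ.posSemidef.dotProduct_mulVec_nonneg _] at h
  ext i j
  by_contra hij
  have hcol : E.col j ≠ 0 := fun h0 => hij (congrFun h0 i)
  exact (hQ.dotProduct_mulVec_pos hcol).ne' (h j (Finset.mem_univ j))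

theorem objective_eq {n k : ℕ} (X : Matrix (Fin n) (Fin k) ℝ) (D Θ : Matrix (Fin k) (Fin k) ℝ) :
    frobSq (X * Θ - X) + trace (Θᵀ * D * Θ) =
      trace (Θᵀ * (Xᵀ * X + D) * Θ) - 2 * trace (Θᵀ * (Xᵀ * X)) + trace (Xᵀ * X) := by
  have hcross : trace (Xᵀ * (X * Θ)) = trace (Θᵀ * (Xᵀ * X)) := by
    rw [← trace_transpose (Xᵀ * (X * Θ))]
    simp only [transpose_mul, transpose_transpose, Matrix.mul_assoc]
  rw [frobSq_eq_trace]
  simp only [transpose_sub, transpose_mul, Matrix.sub_mul, Matrix.mul_sub, Matrix.mul_add,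
    Matrix.add_mul, trace_add, trace_sub, Matrix.mul_assoc, hcross]
  ring

theorem stmt4 (n k : ℕ) (X : Matrix (Fin n) (Fin k) ℝ) (D : Matrix (Fin k) (Fin k) ℝ)
    (hD : D.IsDiag) (hQ : (Xᵀ * X + D).PosDef) :
    let Q := Xᵀ * X + D
    let Θs := (1 : Matrix (Fin k) (Fin k) ℝ) - Q⁻¹ * D
    ∀ Θ : Matrix (Fin k) (Fin k) ℝ,
      (frobSq (X * Θs - X) + Matrix.trace (Θsᵀ * D * Θs) ≤
        frobSq (X * Θ - X) + Matrix.trace (Θᵀ * D * Θ)) ∧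
      (frobSq (X * Θs - X) + Matrix.trace (Θsᵀ * D * Θs) =
        frobSq (X * Θ - X) + Matrix.trace (Θᵀ * D * Θ) ↔ Θ = Θs) := by
  intro Q Θs Θ
  have hsymm : Qᵀ = Q := hQ.isHermitian.eq
  have hunit : IsUnit Q.det := (isUnit_iff_isUnit_det Q).mp hQ.isUnit
  have hnormal : Q * Θs = Xᵀ * X := by
    simp only [Θs, Matrix.mul_sub, Matrix.mul_one, mul_nonsing_inv_cancel_left Q D hunit]
    simp [Q]
  have hdiff : frobSq (X * Θ - X) + trace (Θᵀ * D * Θ) =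
      frobSq (X * Θs - X) + trace (Θsᵀ * D * Θs) + trace ((Θ - Θs)ᵀ * Q * (Θ - Θs)) := by
    have hcomm := trace_transpose_mul_mul_comm hsymm Θs Θ
    rw [objective_eq X D Θ, objective_eq X D Θs, show Xᵀ * X + D = Q from rfl, ← hnormal]
    simp only [transpose_sub, Matrix.sub_mul, Matrix.mul_sub, trace_sub, hcomm,
      ← Matrix.mul_assoc]
    ring
  have hnonneg := trace_transpose_mul_mul_nonneg hQ (Θ - Θs)
  rw [hdiff]
  refine ⟨le_add_of_nonneg_right hnonneg, ?_⟩
  rw [left_eq_add, trace_transpose_mul_mul_eq_zero_iff hQ, sub_eq_zero]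
end

section
/- Let Y ∈ ℝ^{n×k} be a fixed matrix such that Q = YᵀY is positive definite, and let D ∈ ℝ^{k×k} be a diagonal matrix. Then the function Θ ↦ ‖YΘ − Y‖_F² + 2·tr(D Θ) − tr(D) on ℝ^{k×k} attains its unique global minimum at Θ* = I_k − Q⁻¹D; that is, for every Θ ∈ ℝ^{k×k}, the objective at Θ* is less than or equal to the objective at Θ, with equality if and only if Θ = Θ*. -/
open Matrix

theorem frobSq_nonneg {n k : ℕ} (M : Matrix (Fin n) (Fin k) ℝ) : 0 ≤ frobSq M :=
  Finset.sum_nonneg fun _ _ => Finset.sum_nonneg fun _ _ => sq_nonneg _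

theorem frobSq_eq_zero_iff {n k : ℕ} (M : Matrix (Fin n) (Fin k) ℝ) :
    frobSq M = 0 ↔ M = 0 := by
  rw [frobSq_eq_trace, ← conjTranspose_eq_transpose_of_trivial,
    trace_conjTranspose_mul_self_eq_zero_iff]

theorem frobSq_add {n k : ℕ} (A B : Matrix (Fin n) (Fin k) ℝ) :
    frobSq (A + B) = frobSq A + 2 * trace (Aᵀ * B) + frobSq B := by
  have h : trace (Bᵀ * A) = trace (Aᵀ * B) := by
    rw [← trace_transpose, transpose_mul, transpose_transpose]
  simp only [frobSq_eq_trace, transpose_add, Matrix.add_mul, Matrix.mul_add, trace_add, h]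
  ring

theorem stmt9 (n k : ℕ) (Y : Matrix (Fin n) (Fin k) ℝ) (D : Matrix (Fin k) (Fin k) ℝ)
    (hD : D.IsDiag) (hQ : (Yᵀ * Y).PosDef) :
    let Q := Yᵀ * Y
    let Θs := (1 : Matrix (Fin k) (Fin k) ℝ) - Q⁻¹ * D
    ∀ Θ : Matrix (Fin k) (Fin k) ℝ,
      (frobSq (Y * Θs - Y) + 2 * Matrix.trace (D * Θs) - Matrix.trace D ≤
        frobSq (Y * Θ - Y) + 2 * Matrix.trace (D * Θ) - Matrix.trace D) ∧
      (frobSq (Y * Θs - Y) + 2 * Matrix.trace (D * Θs) - Matrix.trace D =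
        frobSq (Y * Θ - Y) + 2 * Matrix.trace (D * Θ) - Matrix.trace D ↔ Θ = Θs) := by
  intro Q Θs Θ
  have hdet : IsUnit Q.det := (isUnit_iff_isUnit_det Q).mp hQ.isUnit
  obtain ⟨E, rfl⟩ : ∃ E, Θ = E + Θs := ⟨Θ - Θs, (sub_add_cancel _ _).symm⟩
  have hres : Yᵀ * (Y * Θs - Y) = -D := by
    have h : Q * (Q⁻¹ * D) = D := mul_nonsing_inv_cancel_left Q D hdet
    calc Yᵀ * (Y * Θs - Y) = Q * Θs - Q := by rw [Matrix.mul_sub, ← Matrix.mul_assoc]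
      _ = -D := by simp only [Θs, Matrix.mul_sub, h, Matrix.mul_one]; abel
  have hcross : trace ((Y * E)ᵀ * (Y * Θs - Y)) = -trace (D * E) := by
    rw [transpose_mul, Matrix.mul_assoc, hres, Matrix.mul_neg, trace_neg,
      ← trace_transpose (Eᵀ * D), transpose_mul, transpose_transpose, hD.isSymm.eq]
  have hobj : frobSq (Y * (E + Θs) - Y) + 2 * trace (D * (E + Θs)) - trace D =
      frobSq (Y * Θs - Y) + 2 * trace (D * Θs) - trace D + frobSq (Y * E) := by
    rw [Matrix.mul_add, add_sub_assoc (Y * E), frobSq_add, hcross, Matrix.mul_add, trace_add]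
    ring
  have hzero : frobSq (Y * E) = 0 ↔ E = 0 := by
    rw [frobSq_eq_zero_iff]
    refine ⟨fun h => ?_, fun h => by rw [h, Matrix.mul_zero]⟩
    have hQE : Q * E = 0 := by rw [Matrix.mul_assoc, h, Matrix.mul_zero]
    rw [← nonsing_inv_mul_cancel_left Q E hdet, hQE, Matrix.mul_zero]
  rw [hobj]
  refine ⟨le_add_of_nonneg_right (frobSq_nonneg _), ?_⟩
  rw [left_eq_add, hzero, add_eq_right]
end
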